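/- arXiv:2011.10094 — 4 statements merged into one kernel-verified Lean document; each statement's English description precedes it below -/
import Mathlib

section
/- Let g : [0,1] → [0,∞] (extended nonnegative reals) be strictly decreasing with g(1) = 0, and suppose that for all x, y ∈ [0,1], g(x) + g(y) lies in the range of g or in the interval [g(0), ∞]. Let g⁻¹ denote the pseudo-inverse defined by g⁻¹(t) = sup{ z ∈ [0,1] : g(z) > t } (with sup ∅ = 0). Then the function T(x,y) = g⁻¹( min{ g(0), g(x) + g(y) } ) is a t-norm: it is commutative, associative, satisfies T(x,1) = x and T(x,0) = 0, and is monotone non-decreasing in each argument. -/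
open Set
open scoped ENNReal

/-- The pseudo-inverse of a strictly decreasing function is a left inverse on `[0,1]`. -/
theorem StrictAntiOn.sSup_setOf_lt_eq {α : Type*} [Preorder α] {g : ℝ → α}
    (hanti : StrictAntiOn g (Set.Icc (0:ℝ) 1)) {w : ℝ} (hw : w ∈ Set.Icc (0:ℝ) 1) :
    sSup {z | z ∈ Set.Icc (0:ℝ) 1 ∧ g w < g z} = w := by
  have hset : {z | z ∈ Set.Icc (0:ℝ) 1 ∧ g w < g z} = Set.Ico 0 w := by
    ext z
    constructor
    · rintro ⟨hz, hlt⟩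
      exact ⟨hz.1, not_le.1 fun hle => (hanti.antitoneOn hw hz hle).not_gt hlt⟩
    · rintro ⟨hz0, hzw⟩
      have hz : z ∈ Set.Icc (0:ℝ) 1 := ⟨hz0, hzw.le.trans hw.2⟩
      exact ⟨hz, hanti hz hw hzw⟩
  rw [hset]
  rcases hw.1.eq_or_lt with rfl | hpos
  · simp
  · exact csSup_Ico hpos

theorem ENNReal.min_min_add (a b c : ℝ≥0∞) : min a (min a b + c) = min a (b + c) := by
  rcases le_total a b with h | h
  · rw [min_eq_left h, min_eq_left le_self_add, min_eq_left (h.trans le_self_add)]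
  · rw [min_eq_right h]

/-- An additive generator `g : [0,1] → [0,∞]` (strictly decreasing with `g 1 = 0`,
and such that `g x + g y` always lies in the range of `g` on `[0,1]` or beyond `g 0`)
generates a t-norm `T(x,y) = g⁻¹(min (g 0) (g x + g y))`, where the pseudo-inverse is
`g⁻¹(t) = sSup {z ∈ [0,1] | g z > t}` (with `sSup ∅ = 0` in `ℝ`). -/
theorem generator_gives_tnorm (g : ℝ → ℝ≥0∞)
    (hanti : StrictAntiOn g (Set.Icc (0:ℝ) 1))
    (hg1 : g 1 = 0)
    (hrange : ∀ x ∈ Set.Icc (0:ℝ) 1, ∀ y ∈ Set.Icc (0:ℝ) 1,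
      g x + g y ∈ g '' Set.Icc (0:ℝ) 1 ∪ Set.Ici (g 0))
    (ginv : ℝ≥0∞ → ℝ)
    (hginv : ∀ t, ginv t = sSup {z | z ∈ Set.Icc (0:ℝ) 1 ∧ t < g z})
    (T : ℝ → ℝ → ℝ)
    (hT : ∀ x y, T x y = ginv (min (g 0) (g x + g y))) :
    ∀ x ∈ Set.Icc (0:ℝ) 1, ∀ y ∈ Set.Icc (0:ℝ) 1, ∀ z ∈ Set.Icc (0:ℝ) 1,
      (T x y = T y x) ∧
      (T (T x y) z = T x (T y z)) ∧
      (T x 1 = x) ∧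
      (T x 0 = 0) ∧
      (x ≤ y → T x z ≤ T y z) := by
  have h0 : (0:ℝ) ∈ Set.Icc (0:ℝ) 1 := ⟨le_rfl, zero_le_one⟩
  have hinv : ∀ w ∈ Set.Icc (0:ℝ) 1, ginv (g w) = w := fun w hw => by
    rw [hginv, hanti.sSup_setOf_lt_eq hw]
  have hle : ∀ w ∈ Set.Icc (0:ℝ) 1, g w ≤ g 0 := fun w hw => hanti.antitoneOn h0 hw hw.1
  have key : ∀ x ∈ Set.Icc (0:ℝ) 1, ∀ y ∈ Set.Icc (0:ℝ) 1,
      T x y ∈ Set.Icc (0:ℝ) 1 ∧ g (T x y) = min (g 0) (g x + g y) := by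
    intro x hx y hy
    obtain ⟨w, hw, hgw⟩ : ∃ w ∈ Set.Icc (0:ℝ) 1, g w = min (g 0) (g x + g y) := by
      rcases hrange x hx y hy with ⟨w, hw, hgw⟩ | hge
      · exact ⟨w, hw, by rw [← hgw, min_eq_right (hle w hw)]⟩
      · exact ⟨0, h0, (min_eq_left hge).symm⟩
    rw [hT, ← hgw, hinv w hw]
    exact ⟨hw, rfl⟩
  intro x hx y hy z hz
  have gxy := (key x hx y hy).2
  obtain ⟨hyz, gyz⟩ := key y hy z hz
  obtain ⟨hxz, gxz⟩ := key x hx z hz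
  refine ⟨by rw [hT, hT, add_comm], ?_, ?_, ?_, fun h => ?_⟩
  · rw [hT (T x y), hT x (T y z), gxy, gyz, ENNReal.min_min_add, add_comm (g x) (min _ _), ENNReal.min_min_add,
      add_assoc, add_comm (g x)]
  · rw [hT, hg1, add_zero, min_eq_right (hle x hx), hinv x hx]
  · rw [hT, min_eq_left le_add_self, hinv 0 h0]
  · rw [← hanti.le_iff_ge hyz hxz, gyz, gxz]
    exact min_le_min_left _ (add_le_add_left (hanti.antitoneOn hx hy h) _)
end

section
/- Let g : [0,1] → [0,∞] be a strictly decreasing continuous bijection onto the extended nonnegative reals with g(1) = 0 and g(0) = ∞, with inverse g⁻¹, and let T(x,y) = g⁻¹(g(x) + g(y)) be the generated strict t-norm. Then the residuum of T is given by the generator formula: for all x, y ∈ [0,1], sup{ z ∈ [0,1] : T(x,z) ≤ y } = g⁻¹( g(y) ∸ g(x) ), where ∸ denotes truncated subtraction on [0,∞] (i.e., a ∸ b = max{0, a − b}). -/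
open scoped ENNReal

/-- For a strict additive generator `g : [0,1] → [0,∞]` (strictly decreasing continuous
bijection with `g 1 = 0`, `g 0 = ∞`) with inverse `g⁻¹`, the residuum of the generated
strict t-norm `T(x,y) = g⁻¹(g x + g y)` is given by
`sup {z ∈ [0,1] | T x z ≤ y} = g⁻¹(g y ∸ g x)` (truncated subtraction in `[0,∞]`). -/
theorem strict_generator_residuum
    (g : ℝ → ℝ≥0∞) (ginv : ℝ≥0∞ → ℝ)
    (hanti : StrictAntiOn g (Set.Icc (0:ℝ) 1))
    (hcont : ContinuousOn g (Set.Icc (0:ℝ) 1))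
    (hbij : Set.BijOn g (Set.Icc (0:ℝ) 1) Set.univ)
    (hg1 : g 1 = 0) (hg0 : g 0 = ∞)
    (hinv : Set.InvOn ginv g (Set.Icc (0:ℝ) 1) Set.univ)
    (T : ℝ → ℝ → ℝ) (hT : ∀ x y, T x y = ginv (g x + g y)) :
    ∀ x ∈ Set.Icc (0:ℝ) 1, ∀ y ∈ Set.Icc (0:ℝ) 1,
      sSup {z | z ∈ Set.Icc (0:ℝ) 1 ∧ T x z ≤ y} = ginv (g y - g x) := by
  intro x _ y hy
  have hmem : ∀ c, ginv c ∈ Set.Icc (0:ℝ) 1 := fun c ↦ by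
    obtain ⟨z, hz, rfl⟩ := hbij.surjOn (Set.mem_univ c)
    rwa [hinv.1 hz]
  have hg : ∀ c, g (ginv c) = c := fun c ↦ hinv.2 (Set.mem_univ c)
  have residuation : ∀ z ∈ Set.Icc (0:ℝ) 1, T x z ≤ y ↔ z ≤ ginv (g y - g x) := fun z hz ↦ by
    rw [hT, ← hanti.le_iff_ge hy (hmem _), hg, ← hanti.le_iff_ge (hmem _) hz, hg,
      tsub_le_iff_left]
  exact IsGreatest.csSup_eq
    ⟨⟨hmem _, (residuation _ (hmem _)).2 le_rfl⟩, fun z hz ↦ (residuation z hz.1).1 hz.2⟩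
end

section
/- For every real λ with 0 < λ and λ ≠ 1, the Frank function T^F_λ(x,y) = log_λ( 1 + (λ^x − 1)(λ^y − 1)/(λ − 1) ) is a t-norm on [0,1]: it is commutative, associative, satisfies T^F_λ(x,1) = x and T^F_λ(x,0) = 0, is monotone non-decreasing in each argument, and maps [0,1]×[0,1] into [0,1]. -/
/-- The multiplicative generator `x ↦ (a ^ x - 1) / (a - 1)` of the Frank t-norm. -/
noncomputable def frankGenerator (a x : ℝ) : ℝ := (a ^ x - 1) / (a - 1)

lemma frankGenerator_zero (a : ℝ) : frankGenerator a 0 = 0 := by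
  simp [frankGenerator]

lemma frankGenerator_one {a : ℝ} (ha : a ≠ 1) : frankGenerator a 1 = 1 := by
  simp [frankGenerator, div_self (sub_ne_zero.2 ha)]

lemma frankGenerator_strictMono {a : ℝ} (ha : 0 < a) (ha1 : a ≠ 1) :
    StrictMono (frankGenerator a) := by
  intro x y hxy
  unfold frankGenerator
  rcases lt_or_gt_of_ne ha1 with h | h
  · have hpow := Real.rpow_lt_rpow_of_exponent_gt ha h hxy
    exact div_lt_div_of_neg_of_lt (by linarith) (by linarith)
  · have hpow := Real.rpow_lt_rpow_of_exponent_lt h hxy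
    exact div_lt_div_of_pos_right (by linarith) (by linarith)

lemma frankGenerator_mem_Icc {a : ℝ} (ha : 0 < a) (ha1 : a ≠ 1) {x : ℝ} :
    frankGenerator a x ∈ Set.Icc (0 : ℝ) 1 ↔ x ∈ Set.Icc (0 : ℝ) 1 := by
  have hmono := frankGenerator_strictMono ha ha1
  have h0 : 0 ≤ frankGenerator a x ↔ 0 ≤ x := by
    rw [← hmono.le_iff_le (a := 0) (b := x), frankGenerator_zero]
  have h1 : frankGenerator a x ≤ 1 ↔ x ≤ 1 := by
    rw [← hmono.le_iff_le (a := x) (b := 1), frankGenerator_one ha1]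
  rw [Set.mem_Icc, Set.mem_Icc, h0, h1]

/-- The generator turns the Frank operation into multiplication on the unit interval. -/
lemma frankGenerator_logb {a : ℝ} (ha : 0 < a) (ha1 : a ≠ 1) {x y : ℝ}
    (hx : x ∈ Set.Icc (0 : ℝ) 1) (hy : y ∈ Set.Icc (0 : ℝ) 1) :
    frankGenerator a (Real.logb a (1 + (a ^ x - 1) * (a ^ y - 1) / (a - 1))) =
      frankGenerator a x * frankGenerator a y := by
  have hne : a - 1 ≠ 0 := sub_ne_zero.2 ha1
  obtain ⟨h0, h1⟩ := unitInterval.mul_mem ((frankGenerator_mem_Icc ha ha1).2 hx)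
    ((frankGenerator_mem_Icc ha ha1).2 hy)
  have harg : 1 + (a ^ x - 1) * (a ^ y - 1) / (a - 1) =
      (1 - frankGenerator a x * frankGenerator a y) +
        a * (frankGenerator a x * frankGenerator a y) := by
    unfold frankGenerator
    field_simp
    ring
  have hpos : 0 < 1 + (a ^ x - 1) * (a ^ y - 1) / (a - 1) := by
    rw [harg]
    rcases h0.eq_or_lt with h | h
    · simp [← h]
    · have := mul_pos ha h
      linarith
  rw [frankGenerator, Real.rpow_logb ha ha1 hpos, harg]
  field_simp
  ring

/-- For `0 < λ`, `λ ≠ 1`, the Frank function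
`T(x,y) = log_λ (1 + (λ^x - 1)(λ^y - 1)/(λ - 1))` is a t-norm on `[0,1]`. -/
theorem frank_is_tnorm (lam : ℝ) (hlam : 0 < lam) (hlam1 : lam ≠ 1)
    (T : ℝ → ℝ → ℝ)
    (hT : ∀ x y : ℝ,
      T x y = Real.logb lam (1 + (lam ^ x - 1) * (lam ^ y - 1) / (lam - 1))) :
    ∀ x ∈ Set.Icc (0:ℝ) 1, ∀ y ∈ Set.Icc (0:ℝ) 1, ∀ z ∈ Set.Icc (0:ℝ) 1,
      (T x y = T y x) ∧
      (T (T x y) z = T x (T y z)) ∧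
      (T x 1 = x) ∧
      (T x 0 = 0) ∧
      (x ≤ y → T x z ≤ T y z) ∧
      (T x y ∈ Set.Icc (0:ℝ) 1) := by
  intro x hx y hy z hz
  have hmono := frankGenerator_strictMono hlam hlam1
  have hmul {u v : ℝ} (hu : u ∈ Set.Icc (0 : ℝ) 1) (hv : v ∈ Set.Icc (0 : ℝ) 1) :
      frankGenerator lam (T u v) = frankGenerator lam u * frankGenerator lam v := by
    rw [hT, frankGenerator_logb hlam hlam1 hu hv]
  have hmem {u v : ℝ} (hu : u ∈ Set.Icc (0 : ℝ) 1) (hv : v ∈ Set.Icc (0 : ℝ) 1) :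
      T u v ∈ Set.Icc (0 : ℝ) 1 := by
    rw [← frankGenerator_mem_Icc hlam hlam1, hmul hu hv]
    exact unitInterval.mul_mem ((frankGenerator_mem_Icc hlam hlam1).2 hu)
      ((frankGenerator_mem_Icc hlam hlam1).2 hv)
  refine ⟨?_, ?_, ?_, ?_, fun hxy => ?_, hmem hx hy⟩
  · apply hmono.injective
    rw [hmul hx hy, hmul hy hx, mul_comm]
  · apply hmono.injective
    rw [hmul (hmem hx hy) hz, hmul hx hy, hmul hx (hmem hy hz), hmul hy hz, mul_assoc]
  · apply hmono.injective
    rw [hmul hx (by simp), frankGenerator_one hlam1, mul_one]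
  · apply hmono.injective
    rw [hmul hx (by simp), frankGenerator_zero, mul_zero]
  · rw [← hmono.le_iff_le, hmul hx hz, hmul hy hz]
    exact mul_le_mul_of_nonneg_right (hmono.monotone hxy)
      ((frankGenerator_mem_Icc hlam hlam1).2 hz).1
end

section
/- The Schweizer–Sklar family of t-norms is continuous in the parameter at λ = 0 with limit the product t-norm: for all fixed x, y ∈ (0,1], the function λ ↦ (max{0, x^λ + y^λ − 1})^{1/λ} tends to x·y as λ tends to 0 from the right. -/
open Filter

/-- If `f 0 = 1` and `f` has derivative `f'` at `0`, then `f t ^ (1 / t) → exp f'` as `t → 0`. -/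
theorem HasDerivAt.tendsto_rpow_one_div {f : ℝ → ℝ} {f' : ℝ} (hf : HasDerivAt f f' 0)
    (h0 : f 0 = 1) :
    Tendsto (fun t => f t ^ (1 / t)) (nhdsWithin 0 {0}ᶜ) (nhds (Real.exp f')) := by
  have hlog : HasDerivAt (fun t => Real.log (f t)) f' 0 := by
    simpa [h0] using hf.log (by simp [h0])
  have hpos : ∀ᶠ t in nhdsWithin 0 {0}ᶜ, 0 < f t :=
    (hf.continuousAt.eventually (lt_mem_nhds (by simp [h0]))).filter_mono nhdsWithin_le_nhds
  refine ((Real.continuous_exp.tendsto f').comp hlog.tendsto_slope_zero).congr' ?_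
  filter_upwards [hpos] with t ht
  simp [Real.rpow_def_of_pos ht, h0, mul_comm]

/-- The Schweizer–Sklar family of t-norms tends to the product t-norm as the
parameter `λ` tends to `0` from the right: for fixed `x, y ∈ (0,1]`,
`(max 0 (x^λ + y^λ - 1)) ^ (1/λ) → x * y`. -/
theorem schweizer_sklar_tendsto_product :
    ∀ x ∈ Set.Ioc (0:ℝ) 1, ∀ y ∈ Set.Ioc (0:ℝ) 1,
      Tendsto (fun lam : ℝ => (max 0 (x ^ lam + y ^ lam - 1)) ^ (1 / lam))
        (nhdsWithin 0 (Set.Ioi (0:ℝ)))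
        (nhds (x * y)) := by
  rintro x ⟨hx, -⟩ y ⟨hy, -⟩
  have hd : HasDerivAt (fun t : ℝ => x ^ t + y ^ t - 1) (Real.log x + Real.log y) 0 := by
    simpa using ((Real.hasStrictDerivAt_const_rpow hx 0).hasDerivAt.add
      (Real.hasStrictDerivAt_const_rpow hy 0).hasDerivAt).sub_const 1
  have hpos : ∀ᶠ t in nhds (0:ℝ), 0 < x ^ t + y ^ t - 1 :=
    hd.continuousAt.eventually (lt_mem_nhds (by simp))
  have hmax : HasDerivAt (fun t : ℝ => max 0 (x ^ t + y ^ t - 1))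
      (Real.log x + Real.log y) 0 :=
    hd.congr_of_eventuallyEq (hpos.mono fun t ht => max_eq_right ht.le)
  have h := hmax.tendsto_rpow_one_div (by simp)
  rw [Real.exp_add, Real.exp_log hx, Real.exp_log hy] at h
  exact h.mono_left (nhdsWithin_mono 0 fun t ht => ne_of_gt ht)
end
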